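/- arXiv:2508.10375 — 2 statements merged into one kernel-verified Lean document; each statement's English description precedes it below -/
import Mathlib

section
/- Let n ≥ d ≥ 1 be integers and let β be a bivariate sequence of degree 2n such that M_n(β) is positive semidefinite and (y−x^d)-pure. Then β admits a representing measure if and only if there exist real numbers A_{ij}, (i,j) ∈ F, such that the core matrix C[A] is positive semidefinite and recursively generated. -/
open MeasureTheory Matrix

noncomputable section

/-- Index set for the moment matrix `M_n(β)`: pairs `(i,j)` with `i + j ≤ n`. -/
abbrev MomIdx (n : ℕ) : Type :=
  {p : Fin (n + 1) × Fin (n + 1) // (p.1 : ℕ) + (p.2 : ℕ) ≤ n}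

/-- Index set for the compressed moment matrix `M̂_n(β)`: pairs `(i,j)` with
`i + j ≤ n` and `i ≤ d − 1`. -/
abbrev MomIdxHat (n d : ℕ) : Type :=
  {p : Fin (n + 1) × Fin (n + 1) // (p.1 : ℕ) + (p.2 : ℕ) ≤ n ∧ (p.1 : ℕ) < d}

/-- The moment matrix `M_n(β)`, with entry `β_{i+k, j+l}` in row `(i,j)`,
column `(k,l)`. -/
def momentMatrix (n : ℕ) (β : ℕ → ℕ → ℝ) : Matrix (MomIdx n) (MomIdx n) ℝ :=
  Matrix.of fun p q => β ((p.1.1 : ℕ) + (q.1.1 : ℕ)) ((p.1.2 : ℕ) + (q.1.2 : ℕ))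

/-- The compressed moment matrix `M̂_n(β)` (rows and columns `(i,j)` with `i ≤ d−1`). -/
def momentMatrixHat (n d : ℕ) (β : ℕ → ℕ → ℝ) :
    Matrix (MomIdxHat n d) (MomIdxHat n d) ℝ :=
  Matrix.of fun p q => β ((p.1.1 : ℕ) + (q.1.1 : ℕ)) ((p.1.2 : ℕ) + (q.1.2 : ℕ))

/-- `β` is a bivariate sequence of degree `2n` such that `M_n(β)` is positive
semidefinite and `(y − x^d)`-pure: `β_{00} = 1`, `β` satisfies the `(y − x^d)`
column relations, `M_n(β)` is positive semidefinite, and `M̂_n(β)` is positive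
definite. -/
def IsPure (n d : ℕ) (β : ℕ → ℕ → ℝ) : Prop :=
  β 0 0 = 1 ∧
  (∀ i j : ℕ, i + j + d ≤ 2 * n → β (i + d) j = β i (j + 1)) ∧
  (momentMatrix n β).PosSemidef ∧
  (momentMatrixHat n d β).PosDef

/-- `μ` is a representing measure for the bivariate sequence `β` of degree `2n`. -/
def IsRepMeasure (n : ℕ) (β : ℕ → ℕ → ℝ) (μ : Measure (ℝ × ℝ)) : Prop :=
  ∀ i j : ℕ, i + j ≤ 2 * n →
    Integrable (fun p : ℝ × ℝ => p.1 ^ i * p.2 ^ j) μ ∧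
    (∫ p : ℝ × ℝ, p.1 ^ i * p.2 ^ j ∂μ) = β i j

/-- The sequence `γ_p` built from `β` and auxiliary moments `A`:
`γ_p = β_{p mod d, ⌊p/d⌋}` if `(p mod d) + ⌊p/d⌋ ≤ 2n`, else `A_{p mod d, ⌊p/d⌋}`. -/
def coreGamma (n d : ℕ) (β A : ℕ → ℕ → ℝ) (p : ℕ) : ℝ :=
  if p % d + p / d ≤ 2 * n then β (p % d) (p / d) else A (p % d) (p / d)

/-- The `(nd+1) × (nd+1)` core (Hankel) matrix `C[A]` with entries `γ_{p+q}`. -/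
def coreMatrix (n d : ℕ) (β A : ℕ → ℕ → ℝ) :
    Matrix (Fin (n * d + 1)) (Fin (n * d + 1)) ℝ :=
  Matrix.of fun p q => coreGamma n d β A ((p : ℕ) + (q : ℕ))

/-- A real `(N+1) × (N+1)` Hankel matrix `H` is recursively generated if for every
`v ∈ ℝ^N`, whenever `(v, 0)` lies in the kernel of `H`, so does `(0, v)`. -/
def RecGen {N : ℕ} (H : Matrix (Fin (N + 1)) (Fin (N + 1)) ℝ) : Prop :=
  ∀ v : Fin N → ℝ, H.mulVec (Fin.snoc v 0) = 0 → H.mulVec (Fin.cons 0 v) = 0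

/-- A linear map on a finite-dimensional space which is symmetric on a subspace agrees there with
some symmetric operator of the whole space. -/
theorem exists_isSymmetric_eqOn {E : Type*} [NormedAddCommGroup E] [InnerProductSpace ℝ E]
    [FiniteDimensional ℝ E] (W : Submodule ℝ E) (S : E →ₗ[ℝ] E)
    (hS : ∀ x ∈ W, ∀ y ∈ W, inner ℝ (S x) y = inner ℝ x (S y)) :
    ∃ T : E →ₗ[ℝ] E, T.IsSymmetric ∧ ∀ x ∈ W, T x = S x := by
  let P : E →ₗ[ℝ] E := W.starProjection
  have hPmem (x : E) : P x ∈ W := W.starProjection_apply_mem x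
  have hPid (x : E) (hx : x ∈ W) : P x = x := W.starProjection_eq_self_iff.2 hx
  have hPsymm (x y : E) : inner ℝ (P x) y = inner ℝ x (P y) :=
    W.inner_starProjection_left_eq_right x y
  refine ⟨S ∘ₗ P + P ∘ₗ S.adjoint ∘ₗ (LinearMap.id - P), fun x y => ?_, fun x hx => ?_⟩
  · have h := hS _ (hPmem x) _ (hPmem y)
    simp only [LinearMap.add_apply, LinearMap.comp_apply, LinearMap.sub_apply, LinearMap.id_apply,
      inner_add_left, inner_add_right, hPsymm, LinearMap.adjoint_inner_left]
    rw [← hPsymm x, LinearMap.adjoint_inner_right, inner_sub_left, inner_sub_right, h]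
    ring
  · simp [hPid x hx]

/-- If `v i ↦ w i` respects linear relations, it is induced by a linear map. -/
theorem exists_linearMap_apply_eq {ι K E : Type*} [Fintype ι] [Field K] [AddCommGroup E]
    [Module K E] (v w : ι → E) (h : ∀ c : ι → K, ∑ i, c i • v i = 0 → ∑ i, c i • w i = 0) :
    ∃ S : E →ₗ[K] E, ∀ i, S (v i) = w i := by
  classical
  let φ := Fintype.linearCombination K v
  let ψ := Fintype.linearCombination K w
  obtain ⟨g, hg⟩ := φ.rangeRestrict.exists_rightInverse_of_surjective φ.range_rangeRestrict
  obtain ⟨S, hS⟩ := (ψ ∘ₗ g).exists_extend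
  refine ⟨S, fun i => ?_⟩
  set r := φ.rangeRestrict (Pi.single i 1)
  have hr : (r : E) = v i := by simp [r, φ, Fintype.linearCombination_apply_single]
  have hgr : φ (g r) = φ (Pi.single i 1) := congrArg Subtype.val (LinearMap.congr_fun hg r)
  have hker : ψ (g r - Pi.single i 1) = 0 := by
    refine h _ ?_
    change φ (g r - Pi.single i 1) = 0
    rw [map_sub, hgr, sub_self]
  have hψ : ψ (Pi.single i 1) = w i := by simp [ψ, Fintype.linearCombination_apply_single]
  rw [← hr]
  change (S ∘ₗ (LinearMap.range φ).subtype) r = _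
  rw [hS, ← hψ, ← sub_eq_zero, ← hker, map_sub]
  rfl

/-- The spectral theorem for the moments of a symmetric operator. -/
theorem LinearMap.IsSymmetric.inner_pow_apply_eq_sum {E : Type*} [NormedAddCommGroup E]
    [InnerProductSpace ℝ E] [FiniteDimensional ℝ E] {T : E →ₗ[ℝ] E} (hT : T.IsSymmetric)
    {m : ℕ} (hm : Module.finrank ℝ E = m) (u : E) (k : ℕ) :
    inner ℝ ((T ^ k) u) u =
      ∑ i, inner ℝ (hT.eigenvectorBasis hm i) u ^ 2 * hT.eigenvalues hm i ^ k := by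
  have key (i : Fin m) : inner ℝ (hT.eigenvectorBasis hm i) ((T ^ k) u) =
      hT.eigenvalues hm i ^ k * inner ℝ (hT.eigenvectorBasis hm i) u := by
    induction k with
    | zero => simp
    | succ k ih =>
      rw [pow_succ', Module.End.mul_apply, ← hT, hT.apply_eigenvectorBasis,
        RCLike.ofReal_real_eq_id, id_eq, real_inner_smul_left, ih, pow_succ']
      ring
  rw [← (hT.eigenvectorBasis hm).sum_inner_mul_inner]
  refine Finset.sum_congr rfl fun i _ => ?_
  rw [real_inner_comm, key]
  ring

/-- A positive semidefinite, recursively generated Hankel matrix consists of the moments of a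
finitely atomic measure on the line. -/
theorem exists_atoms_of_posSemidef_recGen {N : ℕ} (γ : ℕ → ℝ)
    (hpsd : (Matrix.of fun p q : Fin (N + 1) => γ ((p : ℕ) + (q : ℕ))).PosSemidef)
    (hrec : RecGen (Matrix.of fun p q : Fin (N + 1) => γ ((p : ℕ) + (q : ℕ)))) :
    ∃ (m : ℕ) (w x : Fin m → ℝ), (∀ i, 0 ≤ w i) ∧
      ∀ k ≤ 2 * N, γ k = ∑ i, w i * x i ^ k := by
  set H := Matrix.of fun p q : Fin (N + 1) => γ ((p : ℕ) + (q : ℕ)) with hH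
  obtain ⟨m, B, hB⟩ := Matrix.posSemidef_iff_eq_sum_vecMulVec.1 hpsd
  let u : Fin (N + 1) → EuclideanSpace ℝ (Fin m) := fun p => WithLp.toLp 2 fun k => B k p
  have hu (p q : Fin (N + 1)) : inner ℝ (u p) (u q) = γ ((p : ℕ) + (q : ℕ)) := by
    have := congrFun (congrFun hB p) q
    simp only [hH, Matrix.of_apply, Matrix.sum_apply, Matrix.vecMulVec_apply] at this
    rw [this]
    simp [u, PiLp.inner_apply, mul_comm]
  have hmulVec (c : Fin (N + 1) → ℝ) (p : Fin (N + 1)) :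
      H.mulVec c p = inner ℝ (u p) (∑ q, c q • u q) := by
    simp [Matrix.mulVec, dotProduct, inner_sum, inner_smul_right, hu, hH, mul_comm]
  have hker (c : Fin (N + 1) → ℝ) : H.mulVec c = 0 ↔ ∑ q, c q • u q = 0 := by
    refine ⟨fun h => ?_, fun h => funext fun p => by simp [hmulVec, h]⟩
    rw [← inner_self_eq_zero (𝕜 := ℝ), sum_inner]
    refine Finset.sum_eq_zero fun p _ => ?_
    rw [real_inner_smul_left, ← hmulVec, h, Pi.zero_apply, mul_zero]
  obtain ⟨S, hS⟩ := exists_linearMap_apply_eq (K := ℝ) (fun i : Fin N => u i.castSucc)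
    (fun i => u i.succ) fun c hc => by
      have := (hker _).1 (hrec c ((hker _).2 (by simpa [Fin.sum_univ_castSucc] using hc)))
      simpa [Fin.sum_univ_succ] using this
  obtain ⟨T, hT, hTS⟩ := exists_isSymmetric_eqOn
    (Submodule.span ℝ (Set.range fun i : Fin N => u i.castSucc)) S (by
      intro x hx y hy
      induction hx using Submodule.span_induction with
      | mem x hx =>
        obtain ⟨i, rfl⟩ := hx
        induction hy using Submodule.span_induction with
        | mem y hy =>
          obtain ⟨j, rfl⟩ := hy
          simp only [hS, hu]
          congr 1
          simp only [Fin.val_succ, Fin.val_castSucc]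
          omega
        | zero => simp
        | add y z _ _ hy hz => rw [inner_add_right, map_add, inner_add_right, hy, hz]
        | smul a y _ hy => rw [inner_smul_right, map_smul, inner_smul_right, hy]
      | zero => simp
      | add x z _ _ hx hz => rw [inner_add_left, map_add, inner_add_left, hx, hz]
      | smul a x _ hx => rw [real_inner_smul_left, map_smul, real_inner_smul_left, hx])
  have hpow : ∀ p : Fin (N + 1), (T ^ (p : ℕ)) (u 0) = u p := by
    intro p
    induction p using Fin.induction with
    | zero => simp
    | succ i ih =>
      rw [Fin.val_castSucc] at ih
      rw [Fin.val_succ, pow_succ', Module.End.mul_apply, ih,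
        hTS _ (Submodule.subset_span ⟨i, rfl⟩), hS]
  have hm : Module.finrank ℝ (EuclideanSpace ℝ (Fin m)) = m := finrank_euclideanSpace_fin
  refine ⟨m, fun i => inner ℝ (hT.eigenvectorBasis hm i) (u 0) ^ 2, hT.eigenvalues hm,
    fun i => sq_nonneg _, fun k hk => ?_⟩
  obtain ⟨p, q, hpq⟩ : ∃ p q : Fin (N + 1), (p : ℕ) + (q : ℕ) = k :=
    ⟨⟨min k N, by omega⟩, ⟨k - min k N, by omega⟩, by simp⟩
  rw [← hT.inner_pow_apply_eq_sum hm (u 0), ← hpq, ← hu, ← hpow p, ← hpow q, pow_add,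
    Module.End.mul_apply, hT.pow, real_inner_comm]

/-- If a finite measure has a moment of even order, it has all the power moments of lower order. -/
theorem integrable_pow_of_le {μ : Measure (ℝ × ℝ)} {M : ℕ} (h1 : Integrable (fun _ => (1 : ℝ)) μ)
    (hM : Integrable (fun z : ℝ × ℝ => z.1 ^ (2 * M)) μ) {k : ℕ} (hk : k ≤ 2 * M) :
    Integrable (fun z : ℝ × ℝ => z.1 ^ k) μ := by
  refine (h1.add hM).mono' (by fun_prop) (.of_forall fun z => ?_)
  rw [Real.norm_eq_abs, abs_pow]
  have hev : z.1 ^ (2 * M) = |z.1| ^ (2 * M) := by rw [pow_mul, pow_mul, sq_abs]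
  simp only [Pi.add_apply, hev]
  rcases le_total |z.1| 1 with h | h
  · exact (pow_le_one₀ (abs_nonneg _) h).trans (le_add_of_nonneg_right (by positivity))
  · exact (pow_le_pow_right₀ h hk).trans (le_add_of_nonneg_left zero_le_one)

/-- The Hankel matrix of the first-coordinate moments of a measure is positive semidefinite and
recursively generated. -/
theorem posSemidef_recGen_of_moments {N : ℕ} {μ : Measure (ℝ × ℝ)}
    (hint : ∀ k ≤ 2 * N, Integrable (fun z : ℝ × ℝ => z.1 ^ k) μ)
    (H : Matrix (Fin (N + 1)) (Fin (N + 1)) ℝ)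
    (hH : ∀ p q, H p q = ∫ z, z.1 ^ ((p : ℕ) + (q : ℕ)) ∂μ) :
    H.PosSemidef ∧ RecGen H := by
  let f (v : Fin (N + 1) → ℝ) (z : ℝ × ℝ) : ℝ := ∑ q, v q * z.1 ^ (q : ℕ)
  have hpf (v : Fin (N + 1) → ℝ) (p : Fin (N + 1)) (z : ℝ × ℝ) :
      z.1 ^ (p : ℕ) * f v z = ∑ q, v q * z.1 ^ ((p : ℕ) + (q : ℕ)) := by
    simp only [f, Finset.mul_sum, pow_add]
    exact Finset.sum_congr rfl fun q _ => by ring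
  have hterm (v : Fin (N + 1) → ℝ) (p q : Fin (N + 1)) :
      Integrable (fun z : ℝ × ℝ => v q * z.1 ^ ((p : ℕ) + (q : ℕ))) μ :=
    (hint _ (by omega)).const_mul _
  have hpfint (v : Fin (N + 1) → ℝ) (p : Fin (N + 1)) :
      Integrable (fun z : ℝ × ℝ => z.1 ^ (p : ℕ) * f v z) μ := by
    simp only [hpf]
    exact integrable_finsetSum _ fun q _ => hterm v p q
  have hmul (v : Fin (N + 1) → ℝ) (p : Fin (N + 1)) :
      (H *ᵥ v) p = ∫ z, z.1 ^ (p : ℕ) * f v z ∂μ := by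
    simp only [hpf]
    rw [integral_finsetSum _ fun q _ => hterm v p q]
    simp only [Matrix.mulVec, dotProduct, hH, integral_const_mul, mul_comm]
  have hsq (v : Fin (N + 1) → ℝ) (z : ℝ × ℝ) :
      f v z ^ 2 = ∑ p, v p * (z.1 ^ (p : ℕ) * f v z) := by
    simp only [← mul_assoc, ← Finset.sum_mul]
    exact sq _
  have hsqint (v : Fin (N + 1) → ℝ) : Integrable (fun z => f v z ^ 2) μ := by
    simp only [hsq]
    exact integrable_finsetSum _ fun p _ => (hpfint v p).const_mul _
  have hquad (v : Fin (N + 1) → ℝ) : v ⬝ᵥ (H *ᵥ v) = ∫ z, f v z ^ 2 ∂μ := by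
    simp only [hsq]
    rw [integral_finsetSum _ fun p _ => (hpfint v p).const_mul _]
    simp only [dotProduct, hmul, integral_const_mul]
  refine ⟨.of_dotProduct_mulVec_nonneg ?_ fun v => ?_, fun v hv => ?_⟩
  · ext p q
    simp [hH, add_comm]
  · rw [star_trivial, hquad]
    exact integral_nonneg fun z => sq_nonneg _
  · have h0 : ∫ z, f (Fin.snoc v 0) z ^ 2 ∂μ = 0 := by rw [← hquad, hv, dotProduct_zero]
    rw [integral_eq_zero_iff_of_nonneg (fun z => sq_nonneg _) (hsqint _)] at h0
    funext p
    rw [hmul, Pi.zero_apply]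
    refine integral_eq_zero_of_ae (h0.mono fun z hz => ?_)
    have hfz : f (Fin.snoc v 0) z = 0 := pow_eq_zero_iff two_ne_zero |>.1 hz
    have hcons : f (Fin.cons 0 v) z = z.1 * f (Fin.snoc v 0) z := by
      change ∑ q, _ = z.1 * ∑ q, _
      rw [Fin.sum_univ_succ, Fin.sum_univ_castSucc, mul_add, Finset.mul_sum]
      simp only [Fin.cons_zero, Fin.cons_succ, Fin.snoc_castSucc, Fin.snoc_last, Fin.val_succ,
        Fin.val_castSucc, zero_mul, mul_zero, zero_add, add_zero, pow_succ]
      exact Finset.sum_congr rfl fun q _ => by ring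
    simp [hcons, hfz]

/-- A measure whose moments satisfy the column relations lives on the curve `y = x ^ d`. -/
theorem IsRepMeasure.ae_snd_eq {n d : ℕ} (hd : 1 ≤ d) (hdn : d ≤ n) {β : ℕ → ℕ → ℝ}
    (hcol : ∀ i j : ℕ, i + j + d ≤ 2 * n → β (i + d) j = β i (j + 1))
    {μ : Measure (ℝ × ℝ)} (hμ : IsRepMeasure n β μ) : ∀ᵐ z ∂μ, z.2 = z.1 ^ d := by
  obtain ⟨i02, e02⟩ := hμ 0 2 (by omega)
  obtain ⟨id1, ed1⟩ := hμ d 1 (by omega)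
  obtain ⟨i2d, e2d⟩ := hμ (d + d) 0 (by omega)
  have hsq (z : ℝ × ℝ) : (z.2 - z.1 ^ d) ^ 2 =
      z.1 ^ 0 * z.2 ^ 2 - 2 * (z.1 ^ d * z.2 ^ 1) + z.1 ^ (d + d) * z.2 ^ 0 := by ring
  have hsub : Integrable (fun z : ℝ × ℝ => z.1 ^ 0 * z.2 ^ 2 - 2 * (z.1 ^ d * z.2 ^ 1)) μ :=
    i02.sub (id1.const_mul 2)
  have hint : Integrable (fun z : ℝ × ℝ => (z.2 - z.1 ^ d) ^ 2) μ := by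
    simp only [hsq]
    exact hsub.add i2d
  have h0 : ∫ z : ℝ × ℝ, (z.2 - z.1 ^ d) ^ 2 ∂μ = 0 := by
    simp only [hsq]
    rw [integral_add hsub i2d, integral_sub i02 (id1.const_mul 2),
      integral_const_mul, e02, ed1, e2d, hcol d 0 (by omega)]
    have := hcol 0 1 (by omega)
    rw [zero_add] at this
    rw [this]
    ring
  rw [integral_eq_zero_iff_of_nonneg (fun z => sq_nonneg _) hint] at h0
  exact h0.mono fun z hz => sub_eq_zero.1 (pow_eq_zero_iff two_ne_zero |>.1 hz)

/-- The column relations express every moment through the core sequence. -/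
theorem coreGamma_add_mul {n d : ℕ} (hd : 1 ≤ d) {β : ℕ → ℕ → ℝ}
    (hcol : ∀ i j : ℕ, i + j + d ≤ 2 * n → β (i + d) j = β i (j + 1)) (A : ℕ → ℕ → ℝ)
    (i j : ℕ) (hij : i + j ≤ 2 * n) : coreGamma n d β A (i + d * j) = β i j := by
  induction i using Nat.strong_induction_on generalizing j with
  | _ i ih =>
    rcases lt_or_ge i d with hi | hi
    · have hmod : (i + d * j) % d = i := by rw [Nat.add_mul_mod_self_left, Nat.mod_eq_of_lt hi]
      have hdiv : (i + d * j) / d = j := by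
        rw [Nat.add_mul_div_left _ _ hd, Nat.div_eq_of_lt hi, zero_add]
      rw [coreGamma, hmod, hdiv, if_pos hij]
    · obtain ⟨k, rfl⟩ := Nat.exists_eq_add_of_le' hi
      rw [hcol k j (by omega), ← ih k (by omega) (j + 1) (by omega)]
      congr 1
      ring

/-- A finitely atomic measure on the curve `y = x ^ d` represents `β` as soon as its power moments
are the core sequence. -/
theorem isRepMeasure_sum_dirac {n d m : ℕ} (β : ℕ → ℕ → ℝ) (w x : Fin m → ℝ) (hw : ∀ i, 0 ≤ w i)
    (h : ∀ i j, i + j ≤ 2 * n → β i j = ∑ k, w k * x k ^ (i + d * j)) :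
    IsRepMeasure n β (∑ k, ENNReal.ofReal (w k) • Measure.dirac (x k, x k ^ d)) := by
  intro i j hij
  have hint (k : Fin m) : Integrable (fun z : ℝ × ℝ => z.1 ^ i * z.2 ^ j)
      (ENNReal.ofReal (w k) • Measure.dirac (x k, x k ^ d)) :=
    (integrable_dirac enorm_lt_top).smul_measure ENNReal.ofReal_ne_top
  refine ⟨integrable_finsetSum_measure.2 fun k _ => hint k, ?_⟩
  rw [integral_finsetSum_measure fun k _ => hint k, h i j hij]
  refine Finset.sum_congr rfl fun k _ => ?_
  rw [integral_smul_measure, integral_dirac, ENNReal.toReal_ofReal (hw k), smul_eq_mul, pow_add,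
    pow_mul]

/-- The pure `(y − x^d)` truncated moment problem: `β` admits a representing
measure if and only if there exist auxiliary moments `A` such that the core
matrix `C[A]` is positive semidefinite and recursively generated. -/
theorem pure_momentProblem_iff_core (n d : ℕ) (hd : 1 ≤ d) (hdn : d ≤ n)
    (β : ℕ → ℕ → ℝ) (hpure : IsPure n d β) :
    (∃ μ : Measure (ℝ × ℝ), IsRepMeasure n β μ) ↔
      ∃ A : ℕ → ℕ → ℝ,
        (coreMatrix n d β A).PosSemidef ∧ RecGen (coreMatrix n d β A) := by
  obtain ⟨-, hcol, -, -⟩ := hpure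
  constructor
  · rintro ⟨μ, hμ⟩
    have hae := hμ.ae_snd_eq hd hdn hcol
    have hmono (i j : ℕ) : (fun z : ℝ × ℝ => z.1 ^ i * z.2 ^ j) =ᵐ[μ] fun z => z.1 ^ (i + d * j) :=
      hae.mono fun z hz => by simp only [hz, pow_add, pow_mul]
    have h1 : Integrable (fun _ => (1 : ℝ)) μ := by simpa using (hμ 0 0 (by omega)).1
    have htop : Integrable (fun z : ℝ × ℝ => z.1 ^ (2 * (n * d))) μ := by
      have := (hμ 0 (2 * n) (by omega)).1.congr (hmono _ _)
      rwa [show 0 + d * (2 * n) = 2 * (n * d) by ring] at this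
    refine ⟨fun i j => ∫ z, z.1 ^ (i + d * j) ∂μ, posSemidef_recGen_of_moments
      (fun k hk => integrable_pow_of_le h1 htop hk) _ fun p q => ?_⟩
    simp only [coreMatrix, Matrix.of_apply, coreGamma]
    split_ifs with h
    · rw [← (hμ _ _ h).2, integral_congr_ae (hmono _ _), Nat.mod_add_div]
    · rw [Nat.mod_add_div]
  · rintro ⟨A, hpsd, hrec⟩
    obtain ⟨m, w, x, hw, hx⟩ := exists_atoms_of_posSemidef_recGen (coreGamma n d β A) hpsd hrec
    refine ⟨_, isRepMeasure_sum_dirac β w x hw (d := d) fun i j hij => ?_⟩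
    rw [← coreGamma_add_mul hd hcol A i j hij, hx]
    nlinarith [Nat.mul_le_mul_left d hij, Nat.mul_le_mul_right i hd]
end
end

section
/- Let d ≥ 4 and n ≥ d be integers and let β be a bivariate sequence of degree 2n such that M_n(β) is positive semidefinite and (y−x^d)-pure. For integers p ≥ 0 with (p mod d) + ⌊p/d⌋ ≤ 2n set γ_p := β_{p mod d, ⌊p/d⌋}. Let S := {m ∈ ℤ : 0 ≤ m ≤ nd and (m mod d) + ⌊m/d⌋ ≤ n}, S′ := S ∖ {nd}, m₀ := nd − d² + 3d − 1, C₁ := (γ_{p+q})_{p,q ∈ S′} (which is positive definite), h := (γ_{p+m₀})_{p ∈ S′}, φ := hᵀ C₁⁻¹ h, and λ := γ_{2m₀} = β_{d−2, 2n−2d+5}. If λ < φ, then β admits no representing measure; moreover, if d = 4 and λ = φ, then β admits no representing measure. -/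
open MeasureTheory Matrix

noncomputable section

/-- The univariate sequence `γ_p = β_{p mod d, ⌊p/d⌋}`. -/
def gammad (d : ℕ) (β : ℕ → ℕ → ℝ) (p : ℕ) : ℝ := β (p % d) (p / d)

/-- Index set `S′ = S ∖ {nd}`, where `S = {m : 0 ≤ m ≤ nd, (m mod d) + ⌊m/d⌋ ≤ n}`. -/
abbrev SIdx' (n d : ℕ) : Type :=
  {m : Fin (n * d + 1) // ((m : ℕ) % d + (m : ℕ) / d ≤ n) ∧ (m : ℕ) ≠ n * d}

/-- `m₀ = nd − d² + 3d − 1`. -/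
def m0 (n d : ℕ) : ℕ := n * d - d ^ 2 + 3 * d - 1

/-- The matrix `C₁ = (γ_{p+q})_{p,q ∈ S′}`. -/
def C1big (n d : ℕ) (β : ℕ → ℕ → ℝ) : Matrix (SIdx' n d) (SIdx' n d) ℝ :=
  Matrix.of fun p q => gammad d β ((p.1 : ℕ) + (q.1 : ℕ))

/-- The vector `h = (γ_{p+m₀})_{p ∈ S′}`. -/
def hbig (n d : ℕ) (β : ℕ → ℕ → ℝ) : SIdx' n d → ℝ :=
  fun p => gammad d β ((p.1 : ℕ) + m0 n d)

/-- `φ = hᵀ C₁⁻¹ h`. -/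
def phiBig (n d : ℕ) (β : ℕ → ℕ → ℝ) : ℝ :=
  hbig n d β ⬝ᵥ (C1big n d β)⁻¹ *ᵥ hbig n d β

/-- `λ = γ_{2m₀} = β_{d−2, 2n−2d+5}`. -/
def lamBig (n d : ℕ) (β : ℕ → ℕ → ℝ) : ℝ := gammad d β (2 * m0 n d)

theorem mod_div_add_cases (d : ℕ) (hd : 0 < d) (p q : ℕ) :
    (p % d + q % d < d ∧ (p + q) % d = p % d + q % d ∧ (p + q) / d = p / d + q / d) ∨
    ((p + q) % d + d = p % d + q % d ∧ (p + q) / d = p / d + q / d + 1) := by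
  rcases lt_or_ge (p % d + q % d) d with h | h
  · exact .inl ⟨h, Nat.add_mod_of_add_mod_lt h, Nat.add_div_eq_of_add_mod_lt h⟩
  · exact .inr ⟨Nat.add_mod_add_of_le_add_mod h, Nat.add_div_eq_of_le_mod_add_mod h hd⟩

theorem gammad_add {n d : ℕ} {β : ℕ → ℕ → ℝ} (hd : 0 < d)
    (hrel : ∀ i j : ℕ, i + j + d ≤ 2 * n → β (i + d) j = β i (j + 1)) {p q : ℕ}
    (hp : p % d + p / d ≤ n) (hq : q % d + q / d ≤ n) :
    gammad d β (p + q) = β (p % d + q % d) (p / d + q / d) := by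
  unfold gammad
  rcases mod_div_add_cases d hd p q with ⟨-, h1, h2⟩ | ⟨h1, h2⟩
  · rw [h1, h2]
  · rw [h2, ← h1, hrel]
    omega

theorem C1big_posDef {n d : ℕ} {β : ℕ → ℕ → ℝ} (hd : 0 < d) (hpure : IsPure n d β) :
    (C1big n d β).PosDef := by
  obtain ⟨-, hrel, -, hpd⟩ := hpure
  let e : SIdx' n d → MomIdxHat n d := fun p =>
    ⟨(⟨(p.1 : ℕ) % d, Nat.lt_succ_of_le ((Nat.le_add_right _ _).trans p.2.1)⟩,
      ⟨(p.1 : ℕ) / d, Nat.lt_succ_of_le ((Nat.le_add_left _ _).trans p.2.1)⟩),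
      p.2.1, Nat.mod_lt _ hd⟩
  have he : Function.Injective e := by
    intro p q h
    have h1 : (p.1 : ℕ) % d = (q.1 : ℕ) % d := congrArg (fun t => (t.1.1 : ℕ)) h
    have h2 : (p.1 : ℕ) / d = (q.1 : ℕ) / d := congrArg (fun t => (t.1.2 : ℕ)) h
    apply Subtype.ext
    apply Fin.ext
    rw [← Nat.mod_add_div (p.1 : ℕ) d, ← Nat.mod_add_div (q.1 : ℕ) d, h1, h2]
  have : C1big n d β = (momentMatrixHat n d β).submatrix e e := by
    ext p q
    exact gammad_add hd hrel p.2.1 q.2.1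
  rw [this]
  exact hpd.submatrix he

/-- A quadratic form whose coefficients are the integrals `∫ g i * g j` is the integral of the
square of the corresponding linear combination. -/
theorem integral_sq_linear_combination {α ι : Type*} [MeasurableSpace α] [Fintype ι]
    {μ : Measure α} {g : ι → α → ℝ} {M : ι → ι → ℝ}
    (hg : ∀ i j, Integrable (fun x => g i x * g j x) μ ∧ ∫ x, g i x * g j x ∂μ = M i j)
    (c : ι → ℝ) :
    Integrable (fun x => (∑ i, c i * g i x) ^ 2) μ ∧
      ∫ x, (∑ i, c i * g i x) ^ 2 ∂μ = ∑ i, ∑ j, c i * c j * M i j := by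
  have hsq : (fun x => (∑ i, c i * g i x) ^ 2) =
      fun x => ∑ i, ∑ j, c i * c j * (g i x * g j x) := by
    funext x
    rw [sq, Finset.sum_mul_sum]
    exact Finset.sum_congr rfl fun i _ => Finset.sum_congr rfl fun j _ => by ring
  have hint : ∀ i j, Integrable (fun x => c i * c j * (g i x * g j x)) μ :=
    fun i j => (hg i j).1.const_mul _
  have hint' : ∀ i, Integrable (fun x => ∑ j, c i * c j * (g i x * g j x)) μ :=
    fun i => integrable_finsetSum _ fun j _ => hint i j
  rw [hsq]
  refine ⟨integrable_finsetSum _ fun i _ => hint' i, ?_⟩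
  rw [integral_finsetSum _ fun i _ => hint' i]
  refine Finset.sum_congr rfl fun i _ => ?_
  rw [integral_finsetSum _ fun j _ => hint i j]
  refine Finset.sum_congr rfl fun j _ => ?_
  rw [integral_const_mul, (hg i j).2]

theorem ae_snd_eq_pow {n d : ℕ} {β : ℕ → ℕ → ℝ} {μ : Measure (ℝ × ℝ)} (hd : 1 ≤ d) (hdn : d ≤ n)
    (hrel : ∀ i j : ℕ, i + j + d ≤ 2 * n → β (i + d) j = β i (j + 1))
    (hμ : IsRepMeasure n β μ) : ∀ᵐ z ∂μ, z.2 = z.1 ^ d := by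
  have h02 := hμ 0 2 (by omega)
  have hd1 := hμ d 1 (by omega)
  have h2d := hμ (2 * d) 0 (by omega)
  have e1 : β d 1 = β 0 2 := by simpa using hrel 0 1 (by omega)
  have e2 : β (2 * d) 0 = β d 1 := by rw [two_mul]; exact hrel d 0 (by omega)
  have hfun : (fun z : ℝ × ℝ => (z.2 - z.1 ^ d) ^ 2) = fun z =>
      z.1 ^ 0 * z.2 ^ 2 - 2 * (z.1 ^ d * z.2 ^ 1) + z.1 ^ (2 * d) * z.2 ^ 0 := by
    funext z
    ring
  have hI : Integrable (fun z : ℝ × ℝ => (z.2 - z.1 ^ d) ^ 2) μ := by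
    rw [hfun]
    exact (h02.1.sub (hd1.1.const_mul 2)).add h2d.1
  have h0 : ∫ z : ℝ × ℝ, (z.2 - z.1 ^ d) ^ 2 ∂μ = 0 := by
    have hadd := integral_add (h02.1.sub (hd1.1.const_mul 2)) h2d.1
    have hsub := integral_sub h02.1 (hd1.1.const_mul 2)
    rw [integral_const_mul, h02.2, hd1.2] at hsub
    simp only [Pi.sub_apply] at hadd
    rw [hfun, hadd, hsub, h2d.2, e2, e1]
    ring
  have := (integral_eq_zero_iff_of_nonneg (fun z => sq_nonneg _) hI).1 h0
  filter_upwards [this] with z hz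
  have : (z.2 - z.1 ^ d) ^ 2 = 0 := hz
  exact sub_eq_zero.1 (pow_eq_zero_iff two_ne_zero |>.1 this)

theorem integral_fst_pow {n d : ℕ} {β : ℕ → ℕ → ℝ} {μ : Measure (ℝ × ℝ)}
    (hμ : IsRepMeasure n β μ) (hae : ∀ᵐ z ∂μ, z.2 = z.1 ^ d) {p : ℕ}
    (hp : p % d + p / d ≤ 2 * n) :
    Integrable (fun z : ℝ × ℝ => z.1 ^ p) μ ∧ ∫ z : ℝ × ℝ, z.1 ^ p ∂μ = gammad d β p := by
  have h : (fun z : ℝ × ℝ => z.1 ^ (p % d) * z.2 ^ (p / d)) =ᵐ[μ] fun z => z.1 ^ p := by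
    filter_upwards [hae] with z hz
    rw [hz, ← pow_mul, ← pow_add, Nat.mod_add_div]
  obtain ⟨h1, h2⟩ := hμ _ _ hp
  exact ⟨h1.congr h, by rw [← integral_congr_ae h, h2, gammad]⟩

theorem m0_mod_div {n d : ℕ} (hd : 1 ≤ d) (hdn : d ≤ n) :
    m0 n d % d = d - 1 ∧ m0 n d / d = n - d + 2 := by
  obtain ⟨k, rfl⟩ := Nat.exists_eq_add_of_le hdn
  have h : m0 (d + k) d = (d - 1) + d * (k + 2) := by
    unfold m0
    have : (d + k) * d - d ^ 2 = d * k := by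
      rw [add_mul, sq, Nat.add_sub_cancel_left, mul_comm]
    rw [this, mul_add]
    omega
  rw [h, Nat.add_mul_mod_self_left, Nat.add_mul_div_left _ _ (by omega),
    Nat.mod_eq_of_lt (by omega), Nat.div_eq_of_lt (by omega)]
  omega

theorem add_m0_mod_div_le {n d : ℕ} (hd : 3 ≤ d) (hdn : d ≤ n) (p : SIdx' n d) :
    ((p.1 : ℕ) + m0 n d) % d + ((p.1 : ℕ) + m0 n d) / d ≤ 2 * n := by
  obtain ⟨h1, h2⟩ := m0_mod_div (by omega) hdn
  have hp := p.2.1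
  have hne := p.2.2
  have hdm := Nat.mod_add_div (p.1 : ℕ) d
  rcases mod_div_add_cases d (by omega) (p.1 : ℕ) (m0 n d) with ⟨h3, h4, h5⟩ | ⟨h4, h5⟩
  · have hlt : (p.1 : ℕ) / d ≠ n := by
      intro h
      rw [h, Nat.mul_comm d n] at hdm
      omega
    omega
  · omega

theorem two_mul_m0_mod_div_le {n d : ℕ} (hd : 3 ≤ d) (hdn : d ≤ n) :
    (2 * m0 n d) % d + (2 * m0 n d) / d ≤ 2 * n := by
  obtain ⟨h1, h2⟩ := m0_mod_div (by omega) hdn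
  rw [two_mul]
  rcases mod_div_add_cases d (by omega) (m0 n d) (m0 n d) with ⟨h3, h4, h5⟩ | ⟨h4, h5⟩ <;> omega

theorem add_mod_div_le {n d : ℕ} (hd : 1 ≤ d) {p q : ℕ}
    (hp : p % d + p / d ≤ n) (hq : q % d + q / d ≤ n) :
    (p + q) % d + (p + q) / d ≤ 2 * n := by
  rcases mod_div_add_cases d (by omega) p q with ⟨h3, h4, h5⟩ | ⟨h4, h5⟩ <;> omega

/-- The residual of the orthogonal projection of `x ^ m₀` onto the span of the monomials `x ^ p`,
`p ∈ S'`, has squared `L²` norm `λ - φ`. -/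
theorem integral_residual_sq {n d : ℕ} {β : ℕ → ℕ → ℝ} {μ : Measure (ℝ × ℝ)} (hd : 3 ≤ d)
    (hdn : d ≤ n) (hC : (C1big n d β).PosDef)
    (hμ : IsRepMeasure n β μ) (hae : ∀ᵐ z ∂μ, z.2 = z.1 ^ d) :
    ∃ c : SIdx' n d → ℝ,
      Integrable (fun z : ℝ × ℝ => (z.1 ^ m0 n d - ∑ p, c p * z.1 ^ (p.1 : ℕ)) ^ 2) μ ∧
      ∫ z : ℝ × ℝ, (z.1 ^ m0 n d - ∑ p, c p * z.1 ^ (p.1 : ℕ)) ^ 2 ∂μ =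
        lamBig n d β - phiBig n d β := by
  set c := (C1big n d β)⁻¹ *ᵥ hbig n d β with hc
  have hCc : C1big n d β *ᵥ c = hbig n d β := by
    rw [hc, mulVec_mulVec, mul_nonsing_inv _ ((isUnit_iff_isUnit_det _).1 hC.isUnit), one_mulVec]
  refine ⟨c, ?_⟩
  let e : Option (SIdx' n d) → ℕ := fun o => o.elim (m0 n d) fun p => (p.1 : ℕ)
  let c' : Option (SIdx' n d) → ℝ := fun o => o.elim 1 fun p => -c p
  have hg : ∀ i j, Integrable (fun z : ℝ × ℝ => z.1 ^ e i * z.1 ^ e j) μ ∧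
      ∫ z : ℝ × ℝ, z.1 ^ e i * z.1 ^ e j ∂μ = gammad d β (e i + e j) := by
    intro i j
    simp_rw [← pow_add]
    apply integral_fst_pow hμ hae
    rcases i with _ | p <;> rcases j with _ | q
    · simpa [e, two_mul] using two_mul_m0_mod_div_le hd hdn
    · simpa [e, add_comm] using add_m0_mod_div_le hd hdn q
    · simpa [e] using add_m0_mod_div_le hd hdn p
    · exact add_mod_div_le (by omega) p.2.1 q.2.1
  obtain ⟨h1, h2⟩ := integral_sq_linear_combination (g := fun i (z : ℝ × ℝ) => z.1 ^ e i) hg c'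
  have hfun : (fun z : ℝ × ℝ => (∑ i, c' i * z.1 ^ e i) ^ 2) =
      fun z => (z.1 ^ m0 n d - ∑ p, c p * z.1 ^ (p.1 : ℕ)) ^ 2 := by
    funext z
    simp [Fintype.sum_option, c', e, sub_eq_add_neg]
  rw [hfun] at h1 h2
  refine ⟨h1, h2.trans ?_⟩
  have hquad : ∀ p, ∑ q, c p * c q * gammad d β ((p.1 : ℕ) + (q.1 : ℕ)) =
      c p * hbig n d β p := by
    intro p
    rw [← hCc, mulVec, dotProduct, Finset.mul_sum]
    exact Finset.sum_congr rfl fun q _ => by simp only [C1big, of_apply]; ring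
  have hphi : phiBig n d β = ∑ p, c p * hbig n d β p := by
    rw [phiBig, ← hc, dotProduct_comm, dotProduct]
  have hcross : ∀ p : SIdx' n d, gammad d β (m0 n d + (p.1 : ℕ)) = hbig n d β p := fun p => by
    rw [hbig, add_comm]
  simp only [Fintype.sum_option, c', e, Option.elim, one_mul, mul_one, neg_mul, mul_neg,
    Finset.sum_add_distrib, hquad, hcross, Finset.sum_neg_distrib, hphi, lamBig, two_mul]
  simp only [hbig]
  ring

theorem card_momIdxHat_four_ge {n : ℕ} (hn : 4 ≤ n) :
    4 * n - 2 ≤ Fintype.card (MomIdxHat n 4) := by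
  let m : Fin (4 * n - 2) → ℕ := fun k =>
    if (k : ℕ) < 4 * n - 5 then k else if (k : ℕ) = 4 * n - 3 then 4 * n else k + 1
  let e : Fin (4 * n - 2) → MomIdxHat n 4 := fun k =>
    ⟨(⟨m k % 4, by omega⟩, ⟨m k / 4, by
        have := k.2
        simp only [m]
        split_ifs <;> omega⟩), by
      have := k.2
      simp only [m]
      split_ifs <;> omega⟩
  have he : Function.Injective e := by
    intro k l h
    have h1 : m k % 4 = m l % 4 := congrArg (fun t => (t.1.1 : ℕ)) h
    have h2 : m k / 4 = m l / 4 := congrArg (fun t => (t.1.2 : ℕ)) h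
    have h3 : m k = m l := by omega
    have := k.2
    have := l.2
    apply Fin.ext
    simp only [m] at h3
    split_ifs at h3 <;> omega
  simpa using Fintype.card_le_of_injective e he

/-- If `M̂_n(β)` is positive definite, finitely many vertical lines carrying a representing measure
on the curve `y = x ^ d` are at least as many as the rows of `M̂_n(β)`. -/
theorem card_momIdxHat_le {n d : ℕ} {β : ℕ → ℕ → ℝ} {μ : Measure (ℝ × ℝ)}
    (hpd : (momentMatrixHat n d β).PosDef) (hμ : IsRepMeasure n β μ)
    (hae : ∀ᵐ z ∂μ, z.2 = z.1 ^ d) (R : Finset ℝ) (hR : ∀ᵐ z ∂μ, z.1 ∈ R) :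
    Fintype.card (MomIdxHat n d) ≤ R.card := by
  by_contra! hlt
  let f : (MomIdxHat n d → ℝ) →ₗ[ℝ] (R → ℝ) :=
    (Matrix.of fun (r : R) (p : MomIdxHat n d) =>
      (r : ℝ) ^ (p.1.1 : ℕ) * ((r : ℝ) ^ d) ^ (p.1.2 : ℕ)).mulVecLin
  have hker : LinearMap.ker f ≠ ⊥ := LinearMap.ker_ne_bot_of_finrank_lt (by simpa using hlt)
  obtain ⟨c, hc, hc0⟩ := (Submodule.ne_bot_iff _).1 hker
  have hg : ∀ p q : MomIdxHat n d,
      Integrable (fun z : ℝ × ℝ => (z.1 ^ (p.1.1 : ℕ) * z.2 ^ (p.1.2 : ℕ)) *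
        (z.1 ^ (q.1.1 : ℕ) * z.2 ^ (q.1.2 : ℕ))) μ ∧
      ∫ z : ℝ × ℝ, (z.1 ^ (p.1.1 : ℕ) * z.2 ^ (p.1.2 : ℕ)) *
        (z.1 ^ (q.1.1 : ℕ) * z.2 ^ (q.1.2 : ℕ)) ∂μ = momentMatrixHat n d β p q := by
    intro p q
    have h := hμ ((p.1.1 : ℕ) + (q.1.1 : ℕ)) ((p.1.2 : ℕ) + (q.1.2 : ℕ))
      (by have := p.2.1; have := q.2.1; omega)
    have hfun : (fun z : ℝ × ℝ => (z.1 ^ (p.1.1 : ℕ) * z.2 ^ (p.1.2 : ℕ)) *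
        (z.1 ^ (q.1.1 : ℕ) * z.2 ^ (q.1.2 : ℕ))) = fun z =>
        z.1 ^ ((p.1.1 : ℕ) + (q.1.1 : ℕ)) * z.2 ^ ((p.1.2 : ℕ) + (q.1.2 : ℕ)) := by
      funext z
      ring
    rw [hfun]
    exact h
  have h2 := (integral_sq_linear_combination hg c).2
  have hzero : ∫ z : ℝ × ℝ, (∑ p : MomIdxHat n d,
      c p * (z.1 ^ (p.1.1 : ℕ) * z.2 ^ (p.1.2 : ℕ))) ^ 2 ∂μ = 0 := by
    apply integral_eq_zero_of_ae
    filter_upwards [hae, hR] with z hz hzR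
    have := congrFun (LinearMap.mem_ker.1 hc) ⟨z.1, hzR⟩
    simp only [f, mulVecLin_apply, mulVec, dotProduct, of_apply, Pi.zero_apply] at this
    rw [hz, Pi.zero_apply, sq_eq_zero_iff, ← this]
    exact Finset.sum_congr rfl fun p _ => mul_comm _ _
  have hpos := hpd.dotProduct_mulVec_pos hc0
  rw [hzero] at h2
  have : star c ⬝ᵥ momentMatrixHat n d β *ᵥ c =
      ∑ p, ∑ q, c p * c q * momentMatrixHat n d β p q := by
    simp only [dotProduct, mulVec, Finset.mul_sum, star_trivial]
    exact Finset.sum_congr rfl fun p _ => Finset.sum_congr rfl fun q _ => by ring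
  rw [this, ← h2] at hpos
  exact lt_irrefl _ hpos

open Polynomial in
/-- For `d = 4`, a polynomial `x ^ m₀ - ∑ p, c p * x ^ p` with `p` ranging over `S'` has at most
`4n - 3` real roots. -/
theorem exists_finset_roots_residual_four {n : ℕ} (hn : 4 ≤ n) (c : SIdx' n 4 → ℝ) :
    ∃ R : Finset ℝ, R.card ≤ 4 * n - 3 ∧
      ∀ x : ℝ, x ^ m0 n 4 - ∑ p, c p * x ^ (p.1 : ℕ) = 0 → x ∈ R := by
  obtain ⟨hm1, hm2⟩ := m0_mod_div (d := 4) (by omega) hn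
  let f : ℝ[X] := X ^ m0 n 4 - ∑ p : SIdx' n 4, C (c p) * X ^ (p.1 : ℕ)
  have hcoeff : f.coeff (m0 n 4) = 1 := by
    have : ∀ p : SIdx' n 4, ¬ m0 n 4 = (p.1 : ℕ) := fun p h => by
      have := p.2.1
      rw [← h] at this
      omega
    simp [f, coeff_X_pow, this]
  have hf : f ≠ 0 := by
    intro h
    simp [h] at hcoeff
  have hdeg : f.natDegree ≤ 4 * n - 3 := by
    refine (natDegree_sub_le _ _).trans (max_le ?_ (natDegree_sum_le_of_forall_le _ _ ?_))
    · rw [natDegree_X_pow]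
      omega
    · intro p _
      refine (natDegree_C_mul_X_pow_le _ _).trans ?_
      have := p.2.1
      have := p.2.2
      omega
  refine ⟨f.roots.toFinset, (Multiset.toFinset_card_le _).trans ((card_roots' f).trans hdeg), ?_⟩
  intro x hx
  rw [Multiset.mem_toFinset, mem_roots hf, IsRoot.def, ← hx]
  simp [f, eval_finsetSum]

/-- For `d ≥ 4`: the matrix `C₁` is positive definite, and if `λ < φ` then `β`
admits no representing measure; moreover if `d = 4` and `λ = φ` then `β` admits
no representing measure. -/
theorem pure_no_measure_test (n d : ℕ) (hd : 4 ≤ d) (hdn : d ≤ n)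
    (β : ℕ → ℕ → ℝ) (hpure : IsPure n d β) :
    (C1big n d β).PosDef ∧
    (lamBig n d β < phiBig n d β → ¬ ∃ μ : Measure (ℝ × ℝ), IsRepMeasure n β μ) ∧
    (d = 4 → lamBig n d β = phiBig n d β →
      ¬ ∃ μ : Measure (ℝ × ℝ), IsRepMeasure n β μ) := by
  have hC := C1big_posDef (by omega) hpure
  obtain ⟨-, hrel, -, hpd⟩ := hpure
  refine ⟨hC, ?_, ?_⟩
  · rintro hlt ⟨μ, hμ⟩
    have hae := ae_snd_eq_pow (by omega) hdn hrel hμ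
    obtain ⟨c, -, h⟩ := integral_residual_sq (by omega) hdn hC hμ hae
    have : 0 ≤ lamBig n d β - phiBig n d β := h ▸ integral_nonneg fun z => sq_nonneg _
    linarith
  · rintro rfl heq ⟨μ, hμ⟩
    have hae := ae_snd_eq_pow (by omega) hdn hrel hμ
    obtain ⟨c, hI, h⟩ := integral_residual_sq (by omega) hdn hC hμ hae
    rw [heq, sub_self, integral_eq_zero_iff_of_nonneg (fun z => sq_nonneg _) hI] at h
    obtain ⟨R, hRcard, hR⟩ := exists_finset_roots_residual_four hdn c
    have hRae : ∀ᵐ z ∂μ, z.1 ∈ R := by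
      filter_upwards [h] with z hz
      exact hR _ (sq_eq_zero_iff.1 hz)
    have h1 := card_momIdxHat_le hpd hμ hae R hRae
    have h2 := card_momIdxHat_four_ge hdn
    omega
end
end
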